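/- arXiv:math/0306248 — 2 statements merged into one kernel-verified Lean document; each statement's English description precedes it below -/
import Mathlib

section
/- Let β ∈ (0, 1/2^{|S|}) and ε ∈ (0, β(1−β)/(L·|S|⁴)). Let q be an irreducible transition matrix on S and let q̂ be a transition matrix on S that is (ε,β)-close to q. Then q̂ is irreducible. -/
open Finset

namespace PerturbedMC

variable {S : Type*} [Fintype S] [DecidableEq S]

/-- `q` is a (row-stochastic) transition matrix on `S`: `q s t` is the probability of moving
from `s` to `t`. -/
def IsTransition (q : Matrix S S ℝ) : Prop :=
  (∀ s t, 0 ≤ q s t) ∧ ∀ s, ∑ t, q s t = 1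

/-- `q` is irreducible. -/
def IsIrreducible (q : Matrix S S ℝ) : Prop :=
  ∀ s t, ∃ n : ℕ, 1 ≤ n ∧ 0 < (q ^ n) s t

/-- `μ` is a stationary distribution of `q`. -/
def IsStationary (q : Matrix S S ℝ) (μ : S → ℝ) : Prop :=
  (∀ s, 0 ≤ μ s) ∧ (∑ s, μ s = 1) ∧ ∀ t, ∑ s, μ s * q s t = μ t

/-- The combinatorial constant `L = ∑_{n=1}^{|S|-1} C(|S|,n) · n^{|S|}`. -/
def Lconst (S : Type*) [Fintype S] : ℕ :=
  ∑ n ∈ Finset.Ico 1 (Fintype.card S), (Fintype.card S).choose n * n ^ Fintype.card S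

/-- `ζ_q`: the minimal stationary outflow over nonempty proper subsets of `S`. -/
noncomputable def zeta (q : Matrix S S ℝ) (μ : S → ℝ) : ℝ :=
  sInf {x : ℝ | ∃ C : Finset S, C.Nonempty ∧ C ≠ Finset.univ ∧
    x = ∑ s ∈ C, μ s * ∑ t ∈ Cᶜ, q s t}

/-- `ζ_q^1`: the minimal stationary outflow over nonempty proper subsets of `S₁`. -/
noncomputable def zeta1 (q : Matrix S S ℝ) (μ : S → ℝ) (S1 : Finset S) : ℝ :=
  sInf {x : ℝ | ∃ C : Finset S, C.Nonempty ∧ C ⊂ S1 ∧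
    x = ∑ s ∈ C, μ s * ∑ t ∈ Cᶜ, q s t}

/-- `q̂` is `(ε,β)`-close to `q`, relative to the threshold `z` (`z = ζ_q` or `z = ζ_q^1`):
`|q̂(t|s) − q(t|s)| ≤ β·q(t|s)` whenever `μ_s q(t|s) ≥ ε·z` or `μ_s q̂(t|s) ≥ ε·z`. -/
def IsClose (q qh : Matrix S S ℝ) (μ : S → ℝ) (z ε β : ℝ) : Prop :=
  ∀ s t, (ε * z ≤ μ s * q s t ∨ ε * z ≤ μ s * qh s t) → |qh s t - q s t| ≤ β * q s t

/-- The substochastic `C × C` restriction `q_C` of `q`. -/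
def subMat (q : Matrix S S ℝ) (C : Finset S) : Matrix S S ℝ :=
  fun u v => if u ∈ C ∧ v ∈ C then q u v else 0

/-- The exit distribution `Q_{s,q}(t|C) = Σ_{n≥0} Σ_{u∈C} (q_C^n)(u|s)·q(t|u)`. -/
noncomputable def exitProb (q : Matrix S S ℝ) (C : Finset S) (s t : S) : ℝ :=
  ∑' n : ℕ, ∑ u ∈ C, ((subMat q C ^ n : Matrix S S ℝ) s u) * q u t

/-- The expected exit time `E_{s,q}[T_{C̄}] = Σ_{n≥0} Σ_{u∈C} (q_C^n)(u|s) ∈ [0,∞]`. -/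
noncomputable def expExit (q : Matrix S S ℝ) (C : Finset S) (s : S) : ENNReal :=
  ∑' n : ℕ, ENNReal.ofReal (∑ u ∈ C, (subMat q C ^ n : Matrix S S ℝ) s u)

/-- `g` has a cycle within `C`. -/
def HasCycle (C : Finset S) (g : S → S) : Prop :=
  ∃ (k : ℕ) (f : ℕ → S), 0 < k ∧ f k = f 0 ∧ (∀ i < k, f i ∈ C) ∧ ∀ i < k, g (f i) = f (i + 1)

/-- `g` is a `C`-graph (the values of `g` outside `C` are irrelevant). -/
def IsCGraph (C : Finset S) (g : S → S) : Prop := ¬ HasCycle C g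

/-- `s` leads to `t` along `g`: `t` is the first state outside `C` on the `g`-orbit of `s`. -/
def LeadsTo (C : Finset S) (g : S → S) (s t : S) : Prop :=
  ∃ n : ℕ, g^[n] s = t ∧ t ∉ C ∧ ∀ m < n, g^[m] s ∈ C

/-- The weight `p(g) = Π_{s∈C} q(g(s)|s)` of a `C`-graph under `q`. -/
def wt (q : Matrix S S ℝ) (C : Finset S) (g : S → S) : ℝ := ∏ s ∈ C, q s (g s)

/-- `G(C)`: the canonical representatives of `C`-graphs, namely the maps `S → S` that are
`C`-graphs and are the identity outside `C`. -/
noncomputable def Gset (C : Finset S) : Finset (S → S) :=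
  @Finset.filter _ (fun g => IsCGraph C g ∧ ∀ s ∉ C, g s = s) (Classical.decPred _) Finset.univ

/-- `G_{s,t}(C)`: the `C`-graphs along which `s` leads to `t`. -/
noncomputable def GsetLead (C : Finset S) (s t : S) : Finset (S → S) :=
  @Finset.filter _ (fun g => LeadsTo C g s t) (Classical.decPred _) (Gset C)

/-- `g` is an `η`-maximal `C`-graph under `q`: `p(g) ≥ η · max_{g' ∈ G(C)} p(g')`. -/
def IsMaximal (q : Matrix S S ℝ) (C : Finset S) (η : ℝ) (g : S → S) : Prop :=
  IsCGraph C g ∧ ∀ g', IsCGraph C g' → η * wt q C g' ≤ wt q C g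

/-- `H = G^β(C) ∪ Ĝ^β(C)` as a finset of canonical representatives. -/
noncomputable def Hset (q qh : Matrix S S ℝ) (C : Finset S) (β : ℝ) : Finset (S → S) :=
  @Finset.filter _ (fun g => IsMaximal q C β g ∨ IsMaximal qh C β g)
    (Classical.decPred _) (Gset C)

/-- The mixing hypothesis with parameter `a` on `S₁`: for all `s,t ∈ S₁`, the probability
that the chain started at `s`, from its first step onward, reaches `t` before reaching any
state of `S \ S₁`, is at least `a`. -/
def Mixing (q : Matrix S S ℝ) (S1 : Finset S) (a : ℝ) : Prop :=
  ∀ s ∈ S1, ∀ t ∈ S1,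
    a ≤ q s t + ∑ u ∈ S1.erase t, q s u * exitProb q (S1.erase t) u t

/-- `R` is a recurrent class for `q`. -/
def IsRecClass (q : Matrix S S ℝ) (R : Finset S) : Prop :=
  (∀ s ∈ R, ∑ t ∈ Rᶜ, q s t = 0) ∧
    ∀ s ∈ R, ∀ t ∈ R, ∃ n : ℕ, 1 ≤ n ∧ 0 < (q ^ n) s t

theorem IsTransition.pow_nonneg {q : Matrix S S ℝ} (hq : IsTransition q) (n : ℕ) (s t : S) :
    0 ≤ (q ^ n) s t := by
  induction n generalizing t with
  | zero =>
    rw [pow_zero, Matrix.one_apply]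
    split_ifs <;> norm_num
  | succ n ih =>
    rw [pow_succ, Matrix.mul_apply]
    exact Finset.sum_nonneg fun u _ => mul_nonneg (ih u) (hq.1 u t)

/-- A transition matrix that is not irreducible has a nonempty proper closed set of states. -/
theorem IsTransition.exists_closed {q : Matrix S S ℝ} (hq : IsTransition q)
    (h : ¬ IsIrreducible q) :
    ∃ C : Finset S, C.Nonempty ∧ C ≠ Finset.univ ∧ ∀ u ∈ C, ∀ v ∉ C, q u v = 0 := by
  classical
  simp only [IsIrreducible, not_forall] at h
  obtain ⟨s, t, hst⟩ := h
  refine ⟨Finset.univ.filter fun v => ∃ n : ℕ, 1 ≤ n ∧ 0 < (q ^ n) s v, ?_, ?_, ?_⟩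
  · have hpos : 0 < ∑ v, q s v := by rw [hq.2 s]; exact one_pos
    obtain ⟨v, -, hv⟩ := Finset.exists_lt_of_sum_lt (s := Finset.univ) (f := fun _ => (0 : ℝ))
      (g := q s) (by simpa using hpos)
    exact ⟨v, Finset.mem_filter.mpr ⟨Finset.mem_univ v, 1, le_rfl, by rwa [pow_one]⟩⟩
  · intro hC
    have ht := Finset.mem_univ t
    rw [← hC, Finset.mem_filter] at ht
    exact hst ht.2
  · intro u hu v hv
    simp only [Finset.mem_filter, Finset.mem_univ, true_and] at hu hv
    obtain ⟨n, -, hpos⟩ := hu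
    by_contra hne
    refine hv ⟨n + 1, by omega, ?_⟩
    rw [pow_succ, Matrix.mul_apply]
    exact (mul_pos hpos (lt_of_le_of_ne (hq.1 u v) (Ne.symm hne))).trans_le
      (Finset.single_le_sum (f := fun w => (q ^ n) s w * q w v)
        (fun w _ => mul_nonneg (hq.pow_nonneg n s w) (hq.1 w v)) (Finset.mem_univ u))

/-- An irreducible matrix has no nonempty proper closed set of states. -/
theorem IsIrreducible.exists_ne_zero {q : Matrix S S ℝ} (hq : IsIrreducible q) {C : Finset S}
    (hne : C.Nonempty) (huniv : C ≠ Finset.univ) : ∃ u ∈ C, ∃ v ∉ C, q u v ≠ 0 := by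
  by_contra! h
  obtain ⟨s, hs⟩ := hne
  obtain ⟨t, ht⟩ : ∃ t, t ∉ C := by simpa [Finset.eq_univ_iff_forall] using huniv
  have key (n : ℕ) : ∀ v ∉ C, (q ^ n) s v = 0 := by
    induction n with
    | zero =>
      intro v hv
      rw [pow_zero, Matrix.one_apply_ne]
      exact fun hsv => hv (hsv ▸ hs)
    | succ n ih =>
      intro v hv
      rw [pow_succ, Matrix.mul_apply]
      refine Finset.sum_eq_zero fun u _ => ?_
      by_cases hu : u ∈ C
      · rw [h u hu v hv, mul_zero]
      · rw [ih u hu, zero_mul]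
  obtain ⟨n, -, hn⟩ := hq s t
  exact hn.ne' (key n t ht)

theorem outflow_nonneg {q : Matrix S S ℝ} {μ : S → ℝ} (hq : ∀ s t, 0 ≤ q s t)
    (hμ : ∀ s, 0 ≤ μ s) (C : Finset S) : 0 ≤ ∑ s ∈ C, μ s * ∑ t ∈ Cᶜ, q s t :=
  Finset.sum_nonneg fun s _ => mul_nonneg (hμ s) (Finset.sum_nonneg fun t _ => hq s t)

theorem zeta_nonneg {q : Matrix S S ℝ} {μ : S → ℝ} (hq : ∀ s t, 0 ≤ q s t)
    (hμ : ∀ s, 0 ≤ μ s) : 0 ≤ zeta q μ := by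
  apply Real.sInf_nonneg
  rintro x ⟨C, -, -, rfl⟩
  exact outflow_nonneg hq hμ C

theorem zeta_le {q : Matrix S S ℝ} {μ : S → ℝ} (hq : ∀ s t, 0 ≤ q s t) (hμ : ∀ s, 0 ≤ μ s)
    {C : Finset S} (hne : C.Nonempty) (huniv : C ≠ Finset.univ) :
    zeta q μ ≤ ∑ s ∈ C, μ s * ∑ t ∈ Cᶜ, q s t := by
  refine csInf_le ⟨0, ?_⟩ ⟨C, hne, huniv, rfl⟩
  rintro x ⟨D, -, -, rfl⟩
  exact outflow_nonneg hq hμ D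

/-- If every transition from `C` to its complement has stationary flow at most `c`, then the
outflow of `C` is at most `|S|² c`. -/
theorem outflow_le {q : Matrix S S ℝ} {μ : S → ℝ} {C : Finset S} {c : ℝ} (hc : 0 ≤ c)
    (h : ∀ s ∈ C, ∀ t ∉ C, μ s * q s t ≤ c) :
    ∑ s ∈ C, μ s * ∑ t ∈ Cᶜ, q s t ≤ (Fintype.card S : ℝ) ^ 2 * c := by
  calc ∑ s ∈ C, μ s * ∑ t ∈ Cᶜ, q s t
      ≤ ∑ s ∈ C, ∑ t ∈ Cᶜ, c := by
        refine Finset.sum_le_sum fun s hs => ?_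
        rw [Finset.mul_sum]
        exact Finset.sum_le_sum fun t ht => h s hs t (Finset.mem_compl.mp ht)
    _ = (C.card : ℝ) * (Cᶜ.card * c) := by simp only [Finset.sum_const, nsmul_eq_mul]
    _ ≤ Fintype.card S * (Fintype.card S * c) := by
        gcongr <;> exact Finset.card_le_univ _
    _ = (Fintype.card S : ℝ) ^ 2 * c := by ring

/-- if `q̂` is `(ε,β)`-close to the irreducible `q`, then `q̂` is irreducible. -/
theorem perturbed_irreducible
    (hcard : 2 ≤ Fintype.card S)
    (q qh : Matrix S S ℝ) (μ : S → ℝ) (β ε : ℝ)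
    (hβ0 : 0 < β) (hβ1 : β < 1 / 2 ^ Fintype.card S)
    (hε0 : 0 < ε)
    (hε1 : ε < β * (1 - β) / ((Lconst S : ℝ) * (Fintype.card S : ℝ) ^ 4))
    (hq : IsTransition q) (hqirr : IsIrreducible q) (hμ : IsStationary q μ)
    (hqh : IsTransition qh)
    (hclose : IsClose q qh μ (zeta q μ) ε β) :
    IsIrreducible qh := by
  have hβ : β < 1 := hβ1.trans_le (by
    rw [div_le_one (by positivity)]
    exact one_le_pow₀ one_le_two)
  have hε : (Fintype.card S : ℝ) ^ 2 * ε < 1 := by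
    have hn : (1 : ℝ) ≤ Fintype.card S := by exact_mod_cast (by omega : 1 ≤ Fintype.card S)
    have hL : (1 : ℝ) ≤ Lconst S := by
      by_contra! hlt
      have h0 : Lconst S = 0 := by
        have : Lconst S < 1 := by exact_mod_cast hlt
        omega
      rw [h0, Nat.cast_zero, zero_mul, div_zero] at hε1
      exact hε1.not_gt hε0
    rw [lt_div_iff₀ (by positivity)] at hε1
    have hpow : (Fintype.card S : ℝ) ^ 2 ≤ (Lconst S : ℝ) * (Fintype.card S : ℝ) ^ 4 :=
      (pow_le_pow_right₀ hn (by norm_num)).trans (le_mul_of_one_le_left (by positivity) hL)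
    nlinarith [mul_le_mul_of_nonneg_right hpow hε0.le]
  by_contra hirr
  obtain ⟨C, hne, huniv, hC⟩ := hqh.exists_closed hirr
  have hzero : ∀ s ∈ C, ∀ t ∉ C, ε * zeta q μ ≤ μ s * q s t → q s t = 0 := by
    intro s hs t ht hle
    have habs := hclose s t (Or.inl hle)
    rw [hC s hs t ht, zero_sub, abs_neg, abs_of_nonneg (hq.1 s t)] at habs
    nlinarith [hq.1 s t]
  have hζ := zeta_nonneg hq.1 hμ.1
  have hflow : ∀ s ∈ C, ∀ t ∉ C, μ s * q s t ≤ ε * zeta q μ := by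
    intro s hs t ht
    rcases le_total (ε * zeta q μ) (μ s * q s t) with hle | hle
    · rw [hzero s hs t ht hle, mul_zero]
      positivity
    · exact hle
  have hle := (zeta_le hq.1 hμ.1 hne huniv).trans (outflow_le (by positivity) hflow)
  have hζ0 : zeta q μ = 0 := by nlinarith
  obtain ⟨s, hs, t, ht, hst⟩ := hqirr.exists_ne_zero hne huniv
  refine hst (hzero s hs t ht ?_)
  rw [hζ0, mul_zero]
  exact mul_nonneg (hμ.1 s) (hq.1 s t)

end PerturbedMC
end

section
/- Let β ∈ (0, 1/2^{|S|}) and ε ∈ (0, β(1−β)/(L·|S|⁴)). Let q be an irreducible transition matrix on S with stationary distribution μ, and let q̂ be a transition matrix on S that is (ε,β)-close to q. Then q̂ is irreducible and its unique stationary distribution μ̂ satisfies |1 − μ̂_s/μ_s| ≤ 18βL for every s ∈ S. -/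
open Finset

namespace PerturbedMC

variable {S : Type*} [Fintype S] [DecidableEq S]

/-- The flow of the weight `w` out of `C` under `p`. -/
def cutFlow (p : Matrix S S ℝ) (w : S → ℝ) (C : Finset S) : ℝ :=
  ∑ s ∈ C, w s * ∑ t ∈ Cᶜ, p s t

theorem cutFlow_nonneg {p : Matrix S S ℝ} {w : S → ℝ} (hp : ∀ s t, 0 ≤ p s t)
    (hw : ∀ s, 0 ≤ w s) (C : Finset S) : 0 ≤ cutFlow p w C :=
  sum_nonneg fun s _ => mul_nonneg (hw s) (sum_nonneg fun t _ => hp s t)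

/-- A stationary distribution has balanced flow across every cut. -/
theorem IsStationary.cutFlow_compl {p : Matrix S S ℝ} {w : S → ℝ} (hp : IsTransition p)
    (hw : IsStationary p w) (C : Finset S) : cutFlow p w Cᶜ = cutFlow p w C := by
  have h1 : cutFlow p w C + ∑ s ∈ C, w s * ∑ t ∈ C, p s t = ∑ s ∈ C, w s := by
    rw [cutFlow, ← sum_add_distrib]
    refine sum_congr rfl fun s _ => ?_
    rw [← mul_add, sum_compl_add_sum, hp.2 s, mul_one]
  have h2 : cutFlow p w Cᶜ + ∑ s ∈ C, w s * ∑ t ∈ C, p s t = ∑ s ∈ C, w s := by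
    rw [cutFlow, compl_compl, sum_compl_add_sum (s := C)]
    simp only [mul_sum]
    rw [sum_comm]
    exact sum_congr rfl fun t _ => hw.2.2 t
  linarith

theorem zeta_le_cutFlow {q : Matrix S S ℝ} {μ : S → ℝ} (hq : ∀ s t, 0 ≤ q s t)
    (hμ : ∀ s, 0 ≤ μ s) {C : Finset S} (hC : C.Nonempty) (hC' : C ≠ univ) :
    zeta q μ ≤ cutFlow q μ C := by
  refine csInf_le ⟨0, ?_⟩ ⟨C, hC, hC', rfl⟩
  rintro x ⟨D, -, -, rfl⟩
  exact cutFlow_nonneg hq hμ D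

/-- The flow of `μ` across a cut changes by a factor at most `1 ± δ` under a close matrix. -/
theorem IsClose.abs_cutFlow_sub_le {q qh : Matrix S S ℝ} {μ : S → ℝ} {β ε δ : ℝ}
    (hclose : IsClose q qh μ (zeta q μ) ε β) (hβ : 0 ≤ β) (hε : 0 ≤ ε)
    (hδ : β + (Fintype.card S : ℝ) ^ 2 * ε ≤ δ)
    (hq : ∀ s t, 0 ≤ q s t) (hqh : ∀ s t, 0 ≤ qh s t) (hμ : ∀ s, 0 ≤ μ s)
    {C : Finset S} (hC : C.Nonempty) (hC' : C ≠ univ) :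
    |cutFlow qh μ C - cutFlow q μ C| ≤ δ * cutFlow q μ C := by
  have hz := zeta_nonneg hq hμ
  have hzC := zeta_le_cutFlow hq hμ hC hC'
  have hF := cutFlow_nonneg hq hμ C
  have hεz : 0 ≤ ε * zeta q μ := mul_nonneg hε hz
  have entry : ∀ s t, |μ s * qh s t - μ s * q s t| ≤ β * (μ s * q s t) + ε * zeta q μ := by
    intro s t
    have h1 := mul_nonneg (hμ s) (hq s t)
    have h2 := mul_nonneg (hμ s) (hqh s t)
    have h3 := mul_nonneg hβ h1
    by_cases h : ε * zeta q μ ≤ μ s * q s t ∨ ε * zeta q μ ≤ μ s * qh s t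
    · have := mul_le_mul_of_nonneg_left (hclose s t h) (hμ s)
      rw [← mul_sub, abs_mul, abs_of_nonneg (hμ s)]
      linarith
    · push Not at h
      rw [abs_le]
      constructor <;> linarith [h.1, h.2]
  calc |cutFlow qh μ C - cutFlow q μ C|
      = |∑ s ∈ C, ∑ t ∈ Cᶜ, (μ s * qh s t - μ s * q s t)| := by
        simp only [cutFlow, mul_sum, sum_sub_distrib]
    _ ≤ ∑ s ∈ C, ∑ t ∈ Cᶜ, (β * (μ s * q s t) + ε * zeta q μ) :=
        (abs_sum_le_sum_abs _ _).trans (sum_le_sum fun s _ =>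
          (abs_sum_le_sum_abs _ _).trans (sum_le_sum fun t _ => entry s t))
    _ = β * cutFlow q μ C + (#C * #Cᶜ : ℝ) * (ε * zeta q μ) := by
        simp only [cutFlow, mul_sum, sum_add_distrib, sum_const, nsmul_eq_mul, mul_assoc]
    _ ≤ β * cutFlow q μ C + (Fintype.card S : ℝ) ^ 2 * (ε * cutFlow q μ C) := by
        rw [pow_two]
        gcongr <;> apply card_le_univ
    _ ≤ δ * cutFlow q μ C := by
        have := mul_le_mul_of_nonneg_right hδ hF
        linarith

/-- No proper nonempty set is closed for an irreducible matrix. -/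
theorem IsIrreducible.exists_pos {q : Matrix S S ℝ} (hirr : IsIrreducible q)
    (hq : ∀ s t, 0 ≤ q s t) {C : Finset S} (hC : C.Nonempty) (hC' : C ≠ univ) :
    ∃ s ∈ C, ∃ t ∉ C, 0 < q s t := by
  by_contra! h
  obtain ⟨s, hs⟩ := hC
  obtain ⟨t, ht⟩ : ∃ t, t ∉ C := by
    by_contra! h'
    exact hC' (eq_univ_iff_forall.2 h')
  have key : ∀ n : ℕ, ∀ u ∉ C, (q ^ n) s u = 0 := by
    intro n
    induction n with
    | zero =>
      intro u hu
      rw [pow_zero, Matrix.one_apply_ne]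
      rintro rfl
      exact hu hs
    | succ n ih =>
      intro u hu
      rw [pow_succ, Matrix.mul_apply]
      refine sum_eq_zero fun v _ => ?_
      by_cases hv : v ∈ C
      · rw [le_antisymm (h v hv u hu) (hq v u), mul_zero]
      · rw [ih v hv, zero_mul]
  obtain ⟨n, -, hn⟩ := hirr s t
  rw [key n t ht] at hn
  exact lt_irrefl _ hn

/-- A transition matrix without proper nonempty closed sets is irreducible. -/
theorem IsTransition.isIrreducible {q : Matrix S S ℝ} (hq : IsTransition q)
    (h : ∀ C : Finset S, C.Nonempty → C ≠ univ → ∃ s ∈ C, ∃ t ∉ C, 0 < q s t) :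
    IsIrreducible q := by
  classical
  intro s t
  have hnn : ∀ n : ℕ, ∀ u v, 0 ≤ (q ^ n) u v := by
    intro n
    induction n with
    | zero =>
      intro u v
      rw [pow_zero, Matrix.one_apply]
      split_ifs <;> norm_num
    | succ n ih =>
      intro u v
      rw [pow_succ, Matrix.mul_apply]
      exact sum_nonneg fun w _ => mul_nonneg (ih u w) (hq.1 w v)
  let R : Finset S := univ.filter fun u => ∃ n : ℕ, 1 ≤ n ∧ 0 < (q ^ n) s u
  have hne : R.Nonempty := by
    obtain ⟨u, -, hu⟩ : ∃ u ∈ univ, 0 < q s u :=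
      exists_lt_of_sum_lt (by simp [hq.2 s])
    exact ⟨u, mem_filter.2 ⟨mem_univ _, 1, le_rfl, by simpa using hu⟩⟩
  by_cases hR : R = univ
  · have ht : t ∈ R := hR ▸ mem_univ t
    exact (mem_filter.1 ht).2
  · obtain ⟨u, hu, v, hv, huv⟩ := h R hne hR
    obtain ⟨n, hn, hpos⟩ := (mem_filter.1 hu).2
    refine absurd (mem_filter.2 ⟨mem_univ v, n + 1, by omega, ?_⟩) hv
    rw [pow_succ, Matrix.mul_apply]
    exact (mul_pos hpos huv).trans_le
      (single_le_sum (f := fun w => (q ^ n) s w * q w v)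
        (fun w _ => mul_nonneg (hnn n s w) (hq.1 w v)) (mem_univ u))

theorem IsStationary.pos {q : Matrix S S ℝ} {μ : S → ℝ} (hμ : IsStationary q μ)
    (hq : ∀ s t, 0 ≤ q s t) (hirr : IsIrreducible q) (s : S) : 0 < μ s := by
  classical
  by_contra hs
  let C : Finset S := univ.filter fun u => 0 < μ u
  have hne : C.Nonempty := by
    obtain ⟨u, -, hu⟩ : ∃ u ∈ univ, 0 < μ u :=
      exists_lt_of_sum_lt (by simp [hμ.2.1])
    exact ⟨u, mem_filter.2 ⟨mem_univ _, hu⟩⟩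
  have hC : C ≠ univ := fun h => hs (mem_filter.1 (h ▸ mem_univ s : s ∈ C)).2
  obtain ⟨u, hu, v, hv, huv⟩ := hirr.exists_pos hq hne hC
  refine hv (mem_filter.2 ⟨mem_univ v, ?_⟩)
  rw [← hμ.2.2 v]
  exact (mul_pos (mem_filter.1 hu).2 huv).trans_le
    (single_le_sum (f := fun w => μ w * q w v)
      (fun w _ => mul_nonneg (hμ.1 w) (hq w v)) (mem_univ u))

theorem cutFlow_pos {q : Matrix S S ℝ} {μ : S → ℝ} (hq : ∀ s t, 0 ≤ q s t)
    (hirr : IsIrreducible q) (hμ : IsStationary q μ) {C : Finset S}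
    (hC : C.Nonempty) (hC' : C ≠ univ) : 0 < cutFlow q μ C := by
  obtain ⟨s, hs, t, ht, hst⟩ := hirr.exists_pos hq hC hC'
  have h1 : q s t ≤ ∑ t ∈ Cᶜ, q s t :=
    single_le_sum (f := fun t => q s t) (fun t _ => hq s t) (mem_compl.2 ht)
  refine (mul_pos (hμ.pos hq hirr s) (hst.trans_le h1)).trans_le ?_
  exact single_le_sum (f := fun s => μ s * ∑ t ∈ Cᶜ, q s t)
    (fun s _ => mul_nonneg (hμ.1 s) (sum_nonneg fun t _ => hq s t)) hs

/-- If `r * μ` is stationary and, for every cut, the `μ`-flow out is at least `θ` times the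
`μ`-flow in, then `r` varies by at most `θ⁻¹ ^ (|S| - 1)`. -/
theorem pow_mul_le_of_cutFlow {p : Matrix S S ℝ} {μ r : S → ℝ} {θ : ℝ} (hp : IsTransition p)
    (hμ : ∀ s, 0 ≤ μ s) (hr : ∀ s, 0 ≤ r s)
    (hst : IsStationary p fun s => r s * μ s) (hθ0 : 0 ≤ θ) (hθ1 : θ ≤ 1)
    (hcut : ∀ C : Finset S, C.Nonempty → C ≠ univ →
      0 < cutFlow p μ C ∧ θ * cutFlow p μ Cᶜ ≤ cutFlow p μ C) (s t : S) :
    θ ^ (Fintype.card S - 1) * r t ≤ r s := by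
  classical
  let C : ℕ → Finset S := fun k => univ.filter fun u => θ ^ k * r t ≤ r u
  have hmem : ∀ k u, u ∈ C k ↔ θ ^ k * r t ≤ r u := by simp [C]
  have hmono : ∀ k, C k ⊆ C (k + 1) := by
    intro k u hu
    rw [hmem] at hu ⊢
    refine le_trans ?_ hu
    exact mul_le_mul_of_nonneg_right (pow_le_pow_of_le_one hθ0 hθ1 (Nat.le_succ k)) (hr t)
  have ht : ∀ k, t ∈ C k := fun k => by
    rw [hmem]
    exact mul_le_of_le_one_left (hr t) (pow_le_one₀ hθ0 hθ1)
  have hgrow : ∀ k, C k ≠ univ → ∃ u ∈ C (k + 1), u ∉ C k := by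
    intro k hk
    have hne : (C k)ᶜ.Nonempty := by
      rwa [nonempty_iff_ne_empty, ne_eq, compl_eq_empty_iff]
    have hk' : (C k)ᶜ ≠ univ := by
      rw [ne_eq, compl_eq_univ_iff]
      exact ne_empty_of_mem (ht k)
    obtain ⟨u, hu, hmax⟩ := exists_max_image (C k)ᶜ r hne
    refine ⟨u, ?_, mem_compl.1 hu⟩
    have hin := (hcut _ hne hk').1
    have hout := (hcut _ ⟨t, ht k⟩ hk).2
    have hbal := hst.cutFlow_compl hp (C k)
    have h1 : θ ^ k * r t * cutFlow p μ (C k) ≤ cutFlow p (fun s => r s * μ s) (C k) := by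
      rw [cutFlow, cutFlow, mul_sum]
      refine sum_le_sum fun v hv => ?_
      rw [← mul_assoc]
      exact mul_le_mul_of_nonneg_right
        (mul_le_mul_of_nonneg_right ((hmem k v).1 hv) (hμ v)) (sum_nonneg fun w _ => hp.1 v w)
    have h2 : cutFlow p (fun s => r s * μ s) (C k)ᶜ ≤ r u * cutFlow p μ (C k)ᶜ := by
      rw [cutFlow, cutFlow, mul_sum]
      refine sum_le_sum fun v hv => ?_
      rw [← mul_assoc]
      exact mul_le_mul_of_nonneg_right
        (mul_le_mul_of_nonneg_right (hmax v hv) (hμ v)) (sum_nonneg fun w _ => hp.1 v w)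
    have h3 := mul_le_mul_of_nonneg_left hout (mul_nonneg (pow_nonneg hθ0 k) (hr t))
    rw [hmem]
    refine le_of_mul_le_mul_right ?_ hin
    rw [pow_succ]
    linarith
  have hcard : ∀ k, C k = univ ∨ k + 1 ≤ #(C k) := by
    intro k
    induction k with
    | zero => exact Or.inr (card_pos.2 ⟨t, ht 0⟩)
    | succ k ih =>
      by_cases hk : C k = univ
      · exact Or.inl (univ_subset_iff.1 (hk ▸ hmono k))
      · obtain ⟨u, hu, hu'⟩ := hgrow k hk
        have := card_lt_card ((ssubset_iff_of_subset (hmono k)).2 ⟨u, hu, hu'⟩)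
        have := ih.resolve_left hk
        right
        omega
  have huniv : C (Fintype.card S - 1) = univ := by
    refine (hcard _).elim id fun h => ?_
    have : 0 < Fintype.card S := Fintype.card_pos_iff.2 ⟨t⟩
    exact eq_univ_of_card _ (le_antisymm (card_le_univ _) (by omega))
  exact (hmem _ s).1 (huniv ▸ mem_univ s)

theorem two_pow_le_Lconst {T : Type*} [Fintype T] (hcard : 2 ≤ Fintype.card T) :
    2 ^ Fintype.card T ≤ 2 * Lconst T := by
  have h1 : ∑ n ∈ Ico 1 (Fintype.card T), (Fintype.card T).choose n ≤ Lconst T := by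
    refine sum_le_sum fun n hn => Nat.le_mul_of_pos_right _ (pow_pos ?_ _)
    exact (mem_Ico.1 hn).1
  have h2 := Nat.sum_range_choose (Fintype.card T)
  rw [sum_range_succ, Nat.choose_self, range_eq_Ico,
    sum_eq_sum_Ico_succ_bot (by omega), Nat.choose_zero_right] at h2
  have h3 : 2 ^ 2 ≤ 2 ^ Fintype.card T := Nat.pow_le_pow_right (by norm_num) hcard
  simp only [zero_add] at h2
  omega

theorem one_add_pow_le {x : ℝ} (hx0 : 0 ≤ x) (hx1 : x ≤ 1) (n : ℕ) :
    (1 + x) ^ n ≤ 1 + (2 ^ n - 1) * x := by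
  induction n with
  | zero => simp
  | succ n ih =>
    have h1 : (1 : ℝ) ≤ 2 ^ n := one_le_pow₀ (by norm_num)
    have h2 := mul_le_mul_of_nonneg_right ih (by linarith : 0 ≤ 1 + x)
    rw [pow_succ, pow_succ]
    nlinarith [mul_nonneg (mul_nonneg (sub_nonneg.2 h1) hx0) (sub_nonneg.2 hx1)]

/-- Two weights with total masses equal to one whose ratio `r` varies by at most `c`. -/
theorem abs_one_sub_le_of_ratio_bound {T : Type*} [Fintype T] {μ r : T → ℝ} {c : ℝ} (hc0 : 0 < c)
    (hμ : ∀ s, 0 ≤ μ s) (hμ1 : ∑ s, μ s = 1) (hr1 : ∑ s, r s * μ s = 1)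
    (hr : ∀ s t, c * r t ≤ r s) (s : T) : |1 - r s| ≤ c⁻¹ - 1 := by
  have lower : c ≤ r s := by
    have : ∑ t, c * (r t * μ t) ≤ ∑ t, r s * μ t := sum_le_sum fun t _ => by
      rw [← mul_assoc]
      exact mul_le_mul_of_nonneg_right (hr s t) (hμ t)
    rwa [← mul_sum, ← mul_sum, hr1, hμ1, mul_one, mul_one] at this
  have upper : c * r s ≤ 1 := by
    have : ∑ t, c * r s * μ t ≤ ∑ t, r t * μ t := sum_le_sum fun t _ =>
      mul_le_mul_of_nonneg_right (hr t s) (hμ t)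
    rwa [← mul_sum, hr1, hμ1, mul_one] at this
  have h1 : r s ≤ c⁻¹ := by
    rw [← one_div, le_div_iff₀ hc0]
    linarith
  have h2 : 2 ≤ c + c⁻¹ := by
    have h3 : c * c⁻¹ = 1 := mul_inv_cancel₀ hc0.ne'
    have h4 : 0 < c⁻¹ := inv_pos.2 hc0
    nlinarith [sq_nonneg (c - c⁻¹)]
  rw [abs_le]
  constructor <;> linarith

/-- `q̂` is irreducible and its (unique) stationary distribution `μ̂` satisfies
`|1 - μ̂_s/μ_s| ≤ 18βL` for every `s`. -/
theorem perturbed_stationary_close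
    (hcard : 2 ≤ Fintype.card S)
    (q qh : Matrix S S ℝ) (μ : S → ℝ) (β ε : ℝ)
    (hβ0 : 0 < β) (hβ1 : β < 1 / 2 ^ Fintype.card S)
    (hε0 : 0 < ε)
    (hε1 : ε < β * (1 - β) / ((Lconst S : ℝ) * (Fintype.card S : ℝ) ^ 4))
    (hq : IsTransition q) (hqirr : IsIrreducible q) (hμ : IsStationary q μ)
    (hqh : IsTransition qh)
    (hclose : IsClose q qh μ (zeta q μ) ε β) :
    IsIrreducible qh ∧
      ∀ μh : S → ℝ, IsStationary qh μh →
        ∀ s, |1 - μh s / μ s| ≤ 18 * β * (Lconst S : ℝ) := by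
  set N := Fintype.card S with hN
  have hN2 : (2 : ℝ) ≤ N := by exact_mod_cast hcard
  have hL : (2 : ℝ) ^ N ≤ 2 * (Lconst S : ℝ) := by exact_mod_cast two_pow_le_Lconst hcard
  have h4 : (4 : ℝ) ≤ 2 ^ N := by
    calc (4 : ℝ) = 2 ^ 2 := by norm_num
      _ ≤ 2 ^ N := pow_le_pow_right₀ (by norm_num) hcard
  have hβN : β * 2 ^ N < 1 := by rwa [lt_div_iff₀ (by positivity)] at hβ1
  have hβ4 : 4 * β ≤ 1 := by nlinarith
  have hεN : (N : ℝ) ^ 2 * ε ≤ β / 8 := by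
    rw [lt_div_iff₀ (mul_pos (by linarith) (by positivity))] at hε1
    have h8 : (8 : ℝ) ≤ Lconst S * (N : ℝ) ^ 2 := by nlinarith
    have := mul_le_mul_of_nonneg_right h8 (by positivity : 0 ≤ (N : ℝ) ^ 2 * ε)
    nlinarith
  set δ : ℝ := 9 / 8 * β with hδ
  have hμpos := hμ.pos hq.1 hqirr
  have hdiff : ∀ C : Finset S, C.Nonempty → C ≠ univ →
      |cutFlow qh μ C - cutFlow q μ C| ≤ δ * cutFlow q μ C := fun C hC hC' =>
    hclose.abs_cutFlow_sub_le hβ0.le hε0.le (by rw [hδ]; linarith) hq.1 hqh.1 hμ.1 hC hC'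
  have hFpos : ∀ C : Finset S, C.Nonempty → C ≠ univ → 0 < cutFlow qh μ C := by
    intro C hC hC'
    have h1 := (abs_le.1 (hdiff C hC hC')).1
    have h2 := cutFlow_pos hq.1 hqirr hμ hC hC'
    nlinarith
  refine ⟨hqh.isIrreducible fun C hC hC' => ?_, fun μh hμh s => ?_⟩
  · by_contra! h
    refine (hFpos C hC hC').not_ge (sum_nonpos fun s hs => ?_)
    exact mul_nonpos_of_nonneg_of_nonpos (hμ.1 s)
      (sum_nonpos fun t ht => h s hs t (mem_compl.1 ht))
  · have hmul : (fun s => μh s / μ s * μ s) = μh :=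
      funext fun s => div_mul_cancel₀ _ (hμpos s).ne'
    have hθ : ((1 + 4 * β)⁻¹) * (1 + δ) ≤ 1 - δ := by
      rw [inv_mul_le_iff₀ (by linarith), hδ]
      nlinarith
    have hθ0 : 0 < (1 + 4 * β)⁻¹ := inv_pos.2 (by linarith)
    have hratio := pow_mul_le_of_cutFlow (r := fun s => μh s / μ s) (θ := (1 + 4 * β)⁻¹)
      hqh hμ.1 (fun s => div_nonneg (hμh.1 s) (hμ.1 s)) (by rwa [hmul]) hθ0.le
      (inv_le_one_of_one_le₀ (by linarith)) (fun C hC hC' => ⟨hFpos C hC hC', by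
        have h1 := (abs_le.1 (hdiff C hC hC')).1
        have h2 := (abs_le.1 (hdiff Cᶜ
          (by rwa [nonempty_iff_ne_empty, ne_eq, compl_eq_empty_iff])
          (by rwa [ne_eq, compl_eq_univ_iff, ← ne_eq, ← nonempty_iff_ne_empty]))).2
        rw [hμ.cutFlow_compl hq] at h2
        have h3 := mul_le_mul_of_nonneg_right hθ (cutFlow_nonneg hq.1 hμ.1 C)
        have h4 := mul_le_mul_of_nonneg_left h2 hθ0.le
        linarith⟩)
    have hsum : ∑ s, μh s / μ s * μ s = 1 := by
      rw [← hμh.2.1]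
      exact sum_congr rfl fun s _ => div_mul_cancel₀ _ (hμpos s).ne'
    have hbound := abs_one_sub_le_of_ratio_bound (r := fun s => μh s / μ s)
      (pow_pos hθ0 _) hμ.1 hμ.2.1 hsum hratio s
    rw [inv_pow, inv_inv] at hbound
    have hpow := one_add_pow_le (by linarith : 0 ≤ 4 * β) hβ4 (Fintype.card S - 1)
    have hle : (2 : ℝ) ^ (Fintype.card S - 1) ≤ 2 ^ N :=
      pow_le_pow_right₀ (by norm_num) (Nat.sub_le _ _)
    have hβL := mul_le_mul_of_nonneg_left (hle.trans hL) hβ0.le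
    have hL0 : 0 ≤ β * (Lconst S : ℝ) := by positivity
    linarith

end PerturbedMC
end
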